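/- arXiv:2507.21425 — 4 statements merged into one kernel-verified Lean document; each statement's English description precedes it below -/
import Mathlib

section
/- Let n m : ℕ, let T ⊆ ℝ be nonempty, let Γ : ℝ → Matrix (Fin n) (Fin m) ℝ, and let c ≥ 0. Then the multi-impulse reachable set S*(c,T) equals the convex hull (over ℝ) of the single-impulse reachable set S(c,T). -/
open Matrix
open scoped RealInnerProductSpace

/-- Single-impulse reachable set `S(c,T)`: states reachable by one impulse of cost at most `c`
applied at some time in `T`. -/
noncomputable def singleReach (n m : ℕ) (Γ : ℝ → Matrix (Fin n) (Fin m) ℝ) (c : ℝ) (T : Set ℝ) :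
    Set (EuclideanSpace ℝ (Fin n)) :=
  {y | ∃ t ∈ T, ∃ u : EuclideanSpace ℝ (Fin m), ‖u‖ ≤ c ∧ y = (Γ t).mulVec u}

/-- Multi-impulse reachable set `S*(c,T)`: states reachable by finitely many impulses at times in
`T` of total cost at most `c`. -/
noncomputable def multiReach (n m : ℕ) (Γ : ℝ → Matrix (Fin n) (Fin m) ℝ) (c : ℝ) (T : Set ℝ) :
    Set (EuclideanSpace ℝ (Fin n)) :=
  {y | ∃ k : ℕ, ∃ t : Fin k → ℝ, ∃ u : Fin k → EuclideanSpace ℝ (Fin m),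
      (∀ j, t j ∈ T) ∧ (∑ j, ‖u j‖) ≤ c ∧ y = ∑ j, (Γ (t j)).mulVec (u j)}

theorem mem_singleReach_iff {n m : ℕ} {Γ : ℝ → Matrix (Fin n) (Fin m) ℝ} {c : ℝ} {T : Set ℝ}
    {y : EuclideanSpace ℝ (Fin n)} :
    y ∈ singleReach n m Γ c T ↔
      ∃ t ∈ T, ∃ u : EuclideanSpace ℝ (Fin m), ‖u‖ ≤ c ∧ y = (Γ t).toEuclideanLin u := by
  simp only [singleReach, Set.mem_ofPred_eq, PiLp.ext_iff, funext_iff, toLpLin_apply]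

theorem mem_multiReach_iff {n m : ℕ} {Γ : ℝ → Matrix (Fin n) (Fin m) ℝ} {c : ℝ} {T : Set ℝ}
    {y : EuclideanSpace ℝ (Fin n)} :
    y ∈ multiReach n m Γ c T ↔
      ∃ k : ℕ, ∃ t : Fin k → ℝ, ∃ u : Fin k → EuclideanSpace ℝ (Fin m),
        (∀ j, t j ∈ T) ∧ (∑ j, ‖u j‖) ≤ c ∧ y = ∑ j, (Γ (t j)).toEuclideanLin (u j) := by
  simp only [multiReach, Set.mem_ofPred_eq, PiLp.ext_iff, funext_iff, toLpLin_apply,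
    WithLp.ofLp_sum]

theorem singleReach_subset_multiReach (n m : ℕ) (Γ : ℝ → Matrix (Fin n) (Fin m) ℝ) (c : ℝ)
    (T : Set ℝ) : singleReach n m Γ c T ⊆ multiReach n m Γ c T := by
  intro y hy
  obtain ⟨t, ht, u, hu, rfl⟩ := mem_singleReach_iff.1 hy
  exact mem_multiReach_iff.2 ⟨1, fun _ => t, fun _ => u, fun _ => ht, by simpa using hu, by simp⟩

theorem convex_multiReach (n m : ℕ) (Γ : ℝ → Matrix (Fin n) (Fin m) ℝ) (c : ℝ) (T : Set ℝ) :
    Convex ℝ (multiReach n m Γ c T) := by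
  intro x hx y hy a b ha hb hab
  obtain ⟨k, t, u, ht, hu, rfl⟩ := mem_multiReach_iff.1 hx
  obtain ⟨l, s, v, hs, hv, rfl⟩ := mem_multiReach_iff.1 hy
  refine mem_multiReach_iff.2 ⟨k + l, Fin.append t s,
    Fin.append (fun j => a • u j) (fun j => b • v j), ?_, ?_, ?_⟩
  · exact fun j => Fin.addCases (by simpa using ht) (by simpa using hs) j
  · simp only [Fin.sum_univ_add, Fin.append_left, Fin.append_right, norm_smul,
      Real.norm_of_nonneg ha, Real.norm_of_nonneg hb, ← Finset.mul_sum]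
    calc a * ∑ j, ‖u j‖ + b * ∑ j, ‖v j‖ ≤ a * c + b * c := by gcongr
      _ = c := by rw [← add_mul, hab, one_mul]
  · simp [Fin.sum_univ_add, Finset.smul_sum]

theorem multiReach_subset_convexHull_singleReach {n m : ℕ} {T : Set ℝ} (hT : T.Nonempty)
    (Γ : ℝ → Matrix (Fin n) (Fin m) ℝ) {c : ℝ} (hc : 0 ≤ c) :
    multiReach n m Γ c T ⊆ convexHull ℝ (singleReach n m Γ c T) := by
  intro y hy
  obtain ⟨k, t, u, ht, hu, rfl⟩ := mem_multiReach_iff.1 hy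
  set s := ∑ j, ‖u j‖ with hs
  have hs0 : 0 ≤ s := Finset.sum_nonneg fun j _ => norm_nonneg _
  rcases hs0.eq_or_lt with h | h
  · have hz : ∀ j, u j = 0 := fun j => norm_eq_zero.1 <|
      (Finset.sum_eq_zero_iff_of_nonneg fun j _ => norm_nonneg (u j)).1 (hs.symm.trans h.symm) j
        (Finset.mem_univ j)
    obtain ⟨t₀, ht₀⟩ := hT
    exact subset_convexHull ℝ _ (mem_singleReach_iff.2 ⟨t₀, ht₀, 0, by simpa using hc, by simp [hz]⟩)
  · have key : ∀ j, (Γ (t j)).toEuclideanLin (u j) =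
        (‖u j‖ / s) • (Γ (t j)).toEuclideanLin ((s / ‖u j‖) • u j) := by
      intro j
      rcases eq_or_ne (u j) 0 with h0 | h0
      · simp [h0]
      · have := norm_ne_zero_iff.2 h0
        rw [map_smul, smul_smul, div_mul_div_cancel₀ h.ne', div_self this, one_smul]
    rw [Finset.sum_congr rfl fun j _ => key j]
    refine (convex_convexHull ℝ _).sum_mem (fun j _ => by positivity) ?_ fun j _ => ?_
    · rw [← Finset.sum_div, ← hs, div_self h.ne']
    · refine subset_convexHull ℝ _ (mem_singleReach_iff.2 ⟨t j, ht j, _, ?_, rfl⟩)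
      rw [norm_smul, Real.norm_of_nonneg (by positivity), div_mul_eq_mul_div, mul_div_assoc]
      exact (mul_le_of_le_one_right hs0 (div_self_le_one _)).trans hu

/-- The multi-impulse reachable set `S*(c,T)` is the convex hull of the single-impulse
reachable set `S(c,T)`. -/
theorem multiReach_eq_convexHull_singleReach (n m : ℕ) (T : Set ℝ) (hT : T.Nonempty)
    (Γ : ℝ → Matrix (Fin n) (Fin m) ℝ) (c : ℝ) (hc : 0 ≤ c) :
    multiReach n m Γ c T = convexHull ℝ (singleReach n m Γ c T) := by
  exact (multiReach_subset_convexHull_singleReach hT Γ hc).antisymm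
    (convexHull_min (singleReach_subset_multiReach n m Γ c T) (convex_multiReach n m Γ c T))
end

section
/- (Carathéodory bound on the number of impulses.) Let n m : ℕ, T ⊆ ℝ, Γ : ℝ → Matrix (Fin n) (Fin m) ℝ, c ≥ 0, and let ω ∈ S*(c,T). Then there exist k ≤ n + 1, times t₁,…,t_k ∈ T, and controls u₁,…,u_k ∈ ℝᵐ such that ∑_{j=1}^k Γ(t_j) *ᵥ u_j = ω and ∑_{j=1}^k ‖u_j‖₂ ≤ c; i.e., every reachable state can be reached with at most n+1 impulsive maneuvers of no greater total cost. -/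
open Matrix
open scoped RealInnerProductSpace

/-- Carathéodory bound: every state in `S*(c,T)` can be reached with at most `n + 1` impulsive
maneuvers of no greater total cost. -/
theorem multiReach_caratheodory (n m : ℕ) (T : Set ℝ) (Γ : ℝ → Matrix (Fin n) (Fin m) ℝ)
    (c : ℝ) (hc : 0 ≤ c) (ω : EuclideanSpace ℝ (Fin n)) (hω : ω ∈ multiReach n m Γ c T) :
    ∃ k : ℕ, k ≤ n + 1 ∧ ∃ t : Fin k → ℝ, ∃ u : Fin k → EuclideanSpace ℝ (Fin m),
      (∀ j, t j ∈ T) ∧ (∑ j, ‖u j‖) ≤ c ∧ (∑ j, (Γ (t j)).mulVec (u j)) = ω := by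
  obtain ⟨k, t, u, ht, hu, hω⟩ := hω
  set C := ∑ j, ‖u j‖ with hC
  rcases (Finset.sum_nonneg fun j _ => norm_nonneg (u j) : 0 ≤ C).eq_or_lt with hC0 | hC0
  · have hu0 : ∀ j, u j = 0 := fun j => norm_eq_zero.1 <|
      (Finset.sum_eq_zero_iff_of_nonneg fun j _ => norm_nonneg (u j)).1 hC0.symm j
        (Finset.mem_univ j)
    refine ⟨0, Nat.zero_le _, Fin.elim0, Fin.elim0, fun j => j.elim0, by simpa using hc, ?_⟩
    rw [hω]
    simp [hu0]
  · let A : Set (Fin n → ℝ) :=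
      {z | ∃ s ∈ T, ∃ v : EuclideanSpace ℝ (Fin m), ‖v‖ ≤ 1 ∧ (Γ s).mulVec v = z}
    have hmem : ∑ j, (‖u j‖ / C) • (Γ (t j)).mulVec ((‖u j‖⁻¹ • u j : EuclideanSpace ℝ (Fin m)))
        ∈ convexHull ℝ A := by
      refine (convex_convexHull ℝ A).sum_mem (fun j _ => by positivity)
        (by rw [← Finset.sum_div, ← hC, div_self hC0.ne'])
        (fun j _ => subset_convexHull ℝ A ⟨t j, ht j, _, ?_, rfl⟩)
      rw [norm_smul, norm_inv, norm_norm]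
      exact inv_mul_le_one
    obtain ⟨ι, _, z, w, hz, hind, hw, hw1, hsum⟩ := eq_pos_convex_span_of_mem_convexHull hmem
    choose s hs v hv hsv using fun i => hz (Set.mem_range_self i)
    let e := Fintype.equivFin ι
    refine ⟨Fintype.card ι, ?_, s ∘ e.symm, fun j => (C * w (e.symm j)) • v (e.symm j),
      fun j => hs _, ?_, ?_⟩
    · have hcard := hind.card_le_finrank_succ
      have hle := Submodule.finrank_le (vectorSpan ℝ (Set.range z))
      rw [Module.finrank_fin_fun] at hle
      omega
    · rw [e.symm.sum_comp fun i => ‖(C * w i) • v i‖]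
      refine le_trans ?_ hu
      calc ∑ i, ‖(C * w i) • v i‖ ≤ ∑ i, C * w i := by
            refine Finset.sum_le_sum fun i _ => ?_
            have hCw : 0 ≤ C * w i := mul_nonneg hC0.le (hw i).le
            rw [norm_smul, Real.norm_of_nonneg hCw]
            exact mul_le_of_le_one_right hCw (hv i)
        _ = C := by rw [← Finset.mul_sum, hw1, mul_one]
    · rw [hω]
      simp only [Function.comp_apply]
      rw [e.symm.sum_comp fun i => (Γ (s i)).mulVec ((C * w i) • v i : EuclideanSpace ℝ (Fin m))]
      have hscale := congrArg (C • ·) hsum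
      simp only [Finset.smul_sum, smul_smul] at hscale
      simp only [WithLp.ofLp_smul, Matrix.mulVec_smul, hsv, hscale]
      refine Finset.sum_congr rfl fun j _ => ?_
      rcases eq_or_ne (u j) 0 with h | h
      · simp [h]
      · have hn : ‖u j‖ ≠ 0 := norm_ne_zero_iff.2 h
        rw [smul_smul, mul_div_cancel₀ _ hC0.ne', mul_inv_cancel₀ hn, one_smul]
end

section
/- (At most n impulses suffice on the boundary of the reachable set.) Let n m : ℕ with n ≥ 1, let T ⊆ ℝ be nonempty and compact, let Γ : ℝ → Matrix (Fin n) (Fin m) ℝ be continuous, let c ≥ 0, and let ω lie in the topological boundary (frontier) of S*(c,T) in ℝⁿ. Then there exist k ≤ n, times t₁,…,t_k ∈ T, and controls u₁,…,u_k ∈ ℝᵐ such that ∑_{j=1}^k Γ(t_j) *ᵥ u_j = ω and ∑_{j=1}^k ‖u_j‖₂ ≤ c. -/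
open Matrix
open scoped RealInnerProductSpace

/-- The convex hull of a compact subset of a finite-dimensional space is compact. -/
theorem IsCompact.isCompact_convexHull_of_finiteDimensional {E : Type*} [NormedAddCommGroup E]
    [NormedSpace ℝ E] [FiniteDimensional ℝ E] {s : Set E} (hs : IsCompact s) :
    IsCompact (convexHull ℝ s) := by
  obtain rfl | ⟨p, hp⟩ := s.eq_empty_or_nonempty
  · simp
  let N := Module.finrank ℝ E + 1
  let F : (Fin N → ℝ) × (Fin N → E) → E := fun q => ∑ i, q.1 i • q.2 i
  have hF : Continuous F := by fun_prop
  have hK : IsCompact (stdSimplex ℝ (Fin N) ×ˢ Set.univ.pi fun _ : Fin N => s) :=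
    (isCompact_stdSimplex ℝ (Fin N)).prod (isCompact_univ_pi fun _ => hs)
  suffices convexHull ℝ s = F '' (stdSimplex ℝ (Fin N) ×ˢ Set.univ.pi fun _ : Fin N => s) from
    this ▸ hK.image hF
  apply Set.Subset.antisymm
  · intro x hx
    obtain ⟨ι, _, z, w, hz, hi, hw, hw1, rfl⟩ := eq_pos_convex_span_of_mem_convexHull hx
    have hcard : Fintype.card ι ≤ Fintype.card (Fin N) := by
      rw [Fintype.card_fin]
      exact hi.card_le_finrank_succ.trans (Nat.succ_le_succ (Submodule.finrank_le _))
    obtain ⟨e⟩ := Function.Embedding.nonempty_of_card_le hcard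
    have hew (i : ι) : Function.extend e w 0 (e i) = w i := e.injective.extend_apply ..
    have hez (i : ι) : Function.extend e z (fun _ => p) (e i) = z i := e.injective.extend_apply ..
    have hew' (j) (hj : j ∉ Set.range e) : Function.extend e w 0 j = 0 :=
      Function.extend_apply' _ _ _ hj
    refine ⟨(Function.extend e w 0, Function.extend e z fun _ => p), ⟨⟨fun j => ?_, ?_⟩, ?_⟩, ?_⟩
    · by_cases hj : j ∈ Set.range e
      · obtain ⟨i, rfl⟩ := hj
        simpa only [hew] using (hw i).le
      · exact (hew' j hj).ge
    · rw [← hw1]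
      exact (Fintype.sum_of_injective e e.injective _ _ hew' fun i => (hew i).symm).symm
    · intro j _
      by_cases hj : j ∈ Set.range e
      · obtain ⟨i, rfl⟩ := hj
        simpa only [hez] using hz (Set.mem_range_self i)
      · simpa only [Function.extend_apply' _ _ _ hj] using hp
    · refine (Fintype.sum_of_injective e e.injective _ _ (fun j hj => ?_) fun i => ?_).symm
      · simp only [hew' j hj, zero_smul]
      · simp only [hew, hez]
  · rintro _ ⟨⟨w, z⟩, ⟨⟨hw, hw1⟩, hz⟩, rfl⟩
    exact (convex_convexHull ℝ s).sum_mem (fun i _ => hw i) hw1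
      fun i _ => subset_convexHull ℝ s (hz i trivial)

/-- A convex combination, with positive weights, of `finrank ℝ E + 1` affinely independent points
lies in the interior of their convex hull. -/
theorem AffineIndependent.sum_smul_mem_interior_convexHull {ι E : Type*} [Fintype ι]
    [NormedAddCommGroup E] [NormedSpace ℝ E] [FiniteDimensional ℝ E] {z : ι → E}
    (hz : AffineIndependent ℝ z) (hcard : Fintype.card ι = Module.finrank ℝ E + 1) {w : ι → ℝ}
    (hw : ∀ i, 0 < w i) (hw1 : ∑ i, w i = 1) :
    ∑ i, w i • z i ∈ interior (convexHull ℝ (Set.range z)) := by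
  let b : AffineBasis ι ℝ E := ⟨z, hz, hz.affineSpan_eq_top_iff_card_eq_finrank_add_one.2 hcard⟩
  change _ ∈ interior (convexHull ℝ (Set.range b))
  rw [b.interior_convexHull]
  intro i
  have h := b.coord_apply_combination_of_mem (Finset.mem_univ i) hw1
  rw [Finset.affineCombination_eq_linear_combination _ _ _ hw1] at h
  exact (hw i).trans_eq h.symm

section Reach

variable {n m : ℕ} {Γ : ℝ → Matrix (Fin n) (Fin m) ℝ} {c : ℝ} {T : Set ℝ}

theorem isCompact_singleReach (hT : IsCompact T) (hΓ : Continuous Γ) :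
    IsCompact (singleReach n m Γ c T) := by
  have hF : Continuous fun q : ℝ × EuclideanSpace ℝ (Fin m) =>
      (WithLp.toLp 2 (Γ q.1 *ᵥ q.2.ofLp) : EuclideanSpace ℝ (Fin n)) := by fun_prop
  convert! (hT.prod (isCompact_closedBall (0 : EuclideanSpace ℝ (Fin m)) c)).image hF
  ext y
  constructor
  · rintro ⟨t, ht, u, hu, hy⟩
    exact ⟨(t, u), ⟨ht, by simpa using hu⟩, by simp [← hy]⟩
  · rintro ⟨⟨t, u⟩, ⟨ht, hu⟩, rfl⟩
    exact ⟨t, ht, u, by simpa using hu, rfl⟩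

/-- A convex combination of `k` states reachable by one impulse is reachable by `k` impulses of the
same total cost. -/
theorem exists_impulses_of_sum_smul {k : ℕ} {w : Fin k → ℝ} {z : Fin k → EuclideanSpace ℝ (Fin n)}
    (hw : ∀ i, 0 ≤ w i) (hw1 : ∑ i, w i = 1) (hz : ∀ i, z i ∈ singleReach n m Γ c T) :
    ∃ t : Fin k → ℝ, ∃ u : Fin k → EuclideanSpace ℝ (Fin m), (∀ j, t j ∈ T) ∧
      (∑ j, ‖u j‖) ≤ c ∧ (∑ j, (Γ (t j)).mulVec (u j)) = (∑ i, w i • z i).ofLp := by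
  choose t ht u hu hzu using hz
  refine ⟨t, fun i => w i • u i, ht, ?_, ?_⟩
  · calc ∑ j, ‖w j • u j‖ ≤ ∑ j, w j * c := by
          refine Finset.sum_le_sum fun j _ => ?_
          rw [norm_smul, Real.norm_of_nonneg (hw j)]
          exact mul_le_mul_of_nonneg_left (hu j) (hw j)
      _ = c := by rw [← Finset.sum_mul, hw1, one_mul]
  · simp [Matrix.mulVec_smul, hzu, WithLp.ofLp_sum]

theorem multiReach_eq_convexHull (hT : T.Nonempty) (hc : 0 ≤ c) :
    multiReach n m Γ c T = convexHull ℝ (singleReach n m Γ c T) := by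
  apply Set.Subset.antisymm
  · rintro y ⟨k, t, u, ht, hu, hy⟩
    obtain ⟨t₀, ht₀⟩ := hT
    have h0 : (0 : EuclideanSpace ℝ (Fin n)) ∈ singleReach n m Γ c T :=
      ⟨t₀, ht₀, 0, by simpa using hc, by simp⟩
    have hz (j) : (WithLp.toLp 2 (Γ (t j) *ᵥ ((c / ‖u j‖) • u j).ofLp) :
        EuclideanSpace ℝ (Fin n)) ∈ singleReach n m Γ c T := by
      refine ⟨t j, ht j, _, ?_, rfl⟩
      rw [norm_smul, Real.norm_of_nonneg (by positivity)]
      rcases eq_or_ne ‖u j‖ 0 with h | h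
      · simpa [h] using hc
      · exact (div_mul_cancel₀ c h).le
    have hyz : y = ∑ j, (‖u j‖ / c) •
        (WithLp.toLp 2 (Γ (t j) *ᵥ ((c / ‖u j‖) • u j).ofLp) : EuclideanSpace ℝ (Fin n)) := by
      apply WithLp.ofLp_injective 2
      rw [hy, WithLp.ofLp_sum]
      refine Finset.sum_congr rfl fun j _ => ?_
      rcases eq_or_ne (u j) 0 with h | h
      · simp [h]
      · have hcp : c ≠ 0 := by
          rintro rfl
          exact (norm_pos_iff.2 h).not_ge
            ((Finset.single_le_sum (fun i _ => norm_nonneg (u i)) (Finset.mem_univ j)).trans hu)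
        have : ‖u j‖ / c * (c / ‖u j‖) = 1 := by
          have := norm_ne_zero_iff.2 h
          field_simp
        simp [Matrix.mulVec_smul, smul_smul, this]
    have hmem := (convex_convexHull ℝ (singleReach n m Γ c T)).sum_mem
      (t := (Finset.univ : Finset (Option (Fin k))))
      (w := fun o => o.elim (1 - ∑ j, ‖u j‖ / c) fun j => ‖u j‖ / c)
      (z := fun o => o.elim 0 fun j => WithLp.toLp 2 (Γ (t j) *ᵥ ((c / ‖u j‖) • u j).ofLp))
      (by
        rintro (_ | j) -
        · simpa [← Finset.sum_div] using div_le_one_of_le₀ hu hc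
        · exact div_nonneg (norm_nonneg _) hc)
      (by simp [Fintype.sum_option])
      (by
        rintro (_ | j) -
        · exact subset_convexHull ℝ _ h0
        · exact subset_convexHull ℝ _ (hz j))
    simpa only [Fintype.sum_option, Option.elim, smul_zero, zero_add, ← hyz] using hmem
  · intro x hx
    obtain ⟨ι, _, z, w, hz, -, hw, hw1, rfl⟩ := eq_pos_convex_span_of_mem_convexHull hx
    let e := (Fintype.equivFin ι).symm
    obtain ⟨t, u, ht, hu, h⟩ := exists_impulses_of_sum_smul (w := w ∘ e) (z := z ∘ e)
      (fun i => (hw _).le) ((e.sum_comp w).trans hw1) fun i => hz (Set.mem_range_self _)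
    exact ⟨_, t, u, ht, hu, by rw [h, ← e.sum_comp]; rfl⟩

end Reach

/-- On the boundary of the reachable set, at most `n` impulses suffice: if `ω` lies in the
frontier of `S*(c,T)`, it can be reached with at most `n` impulsive maneuvers of total cost at
most `c`. -/
theorem frontier_multiReach_n_impulses (n m : ℕ) (hn : 1 ≤ n) (T : Set ℝ) (hT : T.Nonempty)
    (hTc : IsCompact T) (Γ : ℝ → Matrix (Fin n) (Fin m) ℝ) (hΓ : Continuous Γ)
    (c : ℝ) (hc : 0 ≤ c) (ω : EuclideanSpace ℝ (Fin n))
    (hω : ω ∈ frontier (multiReach n m Γ c T)) :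
    ∃ k : ℕ, k ≤ n ∧ ∃ t : Fin k → ℝ, ∃ u : Fin k → EuclideanSpace ℝ (Fin m),
      (∀ j, t j ∈ T) ∧ (∑ j, ‖u j‖) ≤ c ∧ (∑ j, (Γ (t j)).mulVec (u j)) = ω := by
  rw [multiReach_eq_convexHull hT hc] at hω
  have hclosed :=
    (isCompact_singleReach (c := c) hTc hΓ).isCompact_convexHull_of_finiteDimensional.isClosed
  rw [hclosed.frontier_eq] at hω
  obtain ⟨hmem, hint⟩ := hω
  obtain ⟨ι, _, z, w, hz, hi, hw, hw1, rfl⟩ := eq_pos_convex_span_of_mem_convexHull hmem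
  have hle : Fintype.card ι ≤ Module.finrank ℝ (EuclideanSpace ℝ (Fin n)) + 1 :=
    hi.card_le_finrank_succ.trans (Nat.succ_le_succ (Submodule.finrank_le _))
  have hne : Fintype.card ι ≠ Module.finrank ℝ (EuclideanSpace ℝ (Fin n)) + 1 := fun h =>
    hint (interior_mono (convexHull_mono hz) (hi.sum_smul_mem_interior_convexHull h hw hw1))
  rw [finrank_euclideanSpace_fin] at hle hne
  let e := (Fintype.equivFin ι).symm
  obtain ⟨t, u, ht, hu, h⟩ := exists_impulses_of_sum_smul (w := w ∘ e) (z := z ∘ e)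
    (fun i => (hw _).le) ((e.sum_comp w).trans hw1) fun i => hz (Set.mem_range_self _)
  exact ⟨Fintype.card ι, by lia, t, u, ht, hu, by rw [h, ← e.sum_comp]; rfl⟩
end

section
/- (Invertibility of the state transition matrix.) Let n : ℕ, let A : ℝ → Matrix (Fin n) (Fin n) ℝ be continuous, let t₀ ∈ ℝ, and suppose Ψ : ℝ → Matrix (Fin n) (Fin n) ℝ has derivative Ψ'(t) = A(t) * Ψ(t) at every t ∈ ℝ and satisfies Ψ(t₀) = 1 (the identity matrix). Then Ψ(t) is invertible (a unit in the matrix ring) for every t ∈ ℝ. -/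
open Matrix

attribute [local instance] Matrix.normedAddCommGroup Matrix.normedSpace

/-- A solution of a continuous linear non-autonomous ODE which vanishes at some time vanishes
identically. -/
theorem eq_zero_of_hasDerivAt_clm_apply {E : Type*} [NormedAddCommGroup E] [NormedSpace ℝ E]
    {L : ℝ → E →L[ℝ] E} (hL : Continuous L) {x : ℝ → E}
    (hx : ∀ t, HasDerivAt x (L t (x t)) t) {t₁ : ℝ} (h₁ : x t₁ = 0) (t : ℝ) : x t = 0 := by
  obtain ⟨a, b, ht, ht₁⟩ : ∃ a b, t ∈ Set.Ioo a b ∧ t₁ ∈ Set.Ioo a b :=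
    ⟨min t t₁ - 1, max t t₁ + 1, by grind⟩
  obtain ⟨K, hK⟩ := (isCompact_Icc (a := a) (b := b)).exists_bound_of_continuousOn hL.continuousOn
  have hlip : ∀ s ∈ Set.Ioo a b, LipschitzOnWith K.toNNReal (L s) Set.univ := fun s hs =>
    ((L s).lipschitz.weaken (by
      rw [← NNReal.coe_le_coe, coe_nnnorm]
      exact (hK s (Set.Ioo_subset_Icc_self hs)).trans (Real.le_coe_toNNReal K))).lipschitzOnWith
  refine ODE_solution_unique_of_mem_Ioo (v := fun s => L s) (f := x) (g := fun _ => 0) hlip ht₁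
    (fun s _ => ⟨hx s, trivial⟩) (fun s _ => ⟨?_, trivial⟩) h₁ ht
  simpa using hasDerivAt_const s (0 : E)

/-- Invertibility of the state transition matrix: if `Ψ` solves the matrix ODE `Ψ' = A(t) Ψ`
with continuous `A` and `Ψ(t₀) = 1`, then `Ψ(t)` is a unit in the matrix ring for every `t`. -/
theorem stateTransitionMatrix_isUnit (n : ℕ) (A : ℝ → Matrix (Fin n) (Fin n) ℝ)
    (hA : Continuous A) (t₀ : ℝ) (Ψ : ℝ → Matrix (Fin n) (Fin n) ℝ)
    (hΨd : ∀ t, HasDerivAt Ψ (A t * Ψ t) t) (hΨ0 : Ψ t₀ = 1) :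
    ∀ t, IsUnit (Ψ t) := by
  intro t₁
  rw [← Matrix.mulVec_injective_iff_isUnit]
  refine (injective_iff_map_eq_zero (Matrix.mulVecLin (Ψ t₁))).2 fun v hv => ?_
  let toCLM : Matrix (Fin n) (Fin n) ℝ →ₗ[ℝ] (Fin n → ℝ) →L[ℝ] (Fin n → ℝ) :=
    LinearMap.toContinuousLinearMap.toLinearMap ∘ₗ Matrix.toLin'.toLinearMap
  have hL : Continuous fun t => toCLM (A t) :=
    toCLM.continuous_of_finiteDimensional.comp hA
  let evalAt : Matrix (Fin n) (Fin n) ℝ →L[ℝ] (Fin n → ℝ) :=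
    LinearMap.toContinuousLinearMap ((Matrix.mulVecBilin ℝ ℝ).flip v)
  have hx : ∀ t, HasDerivAt (fun t => Ψ t *ᵥ v) (toCLM (A t) (Ψ t *ᵥ v)) t := fun t => by
    have h := evalAt.hasFDerivAt.comp_hasDerivAt t (hΨd t)
    have he : evalAt (A t * Ψ t) = toCLM (A t) (Ψ t *ᵥ v) :=
      (Matrix.mulVec_mulVec v (A t) (Ψ t)).symm
    rw [← he]
    exact h
  simpa [hΨ0] using eq_zero_of_hasDerivAt_clm_apply hL hx hv t₀
end
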